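/- arXiv:2003.02689 — 2 statements merged into one kernel-verified Lean document; each statement's English description precedes it below -/
import Mathlib

section
/- Let G be a connected simple graph on a finite vertex set V, let A be its adjacency matrix over ℝ, and for k ∈ ℕ let M_k be the matrix with (M_k) i j = 1 if dist(i, j) = k and 0 otherwise. Fix k ≥ 1 and define the mask matrix by Mask i l = 0 if (M_{k−1} + M_k) i l > 0 and Mask i l = 1 otherwise. Then for all i, l, the Hadamard (entrywise) product ((M_k * A) ⊙ Mask) i l is nonzero if and only if dist(i, l) = k + 1. (Correctness of the masking step: applying the mask to M_k · A extracts exactly the rectified (k+1)-order proximity.) -/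
namespace SimpleGraph

variable {V : Type*} {G : SimpleGraph V}

/-- In a connected graph, adjacent vertices have distances to a fixed vertex differing by at
most one. -/
lemma Connected.dist_le_dist_add_one_of_adj (hG : G.Connected) {j l : V} (h : G.Adj j l) (i : V) :
    G.dist i l ≤ G.dist i j + 1 := by
  simpa [dist_eq_one_iff_adj.mpr h] using hG.dist_triangle (u := i) (v := j) (w := l)

/-- A vertex at distance `k + 1` from `i` has a neighbour at distance `k` from `i`. -/
lemma Connected.exists_adj_dist_eq_of_dist_eq_add_one (hG : G.Connected) {i l : V} {k : ℕ}
    (h : G.dist i l = k + 1) : ∃ j, G.dist i j = k ∧ G.Adj j l := by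
  obtain ⟨p, hp⟩ := hG.exists_walk_length_eq_dist l i
  rw [dist_comm, h] at hp
  cases p with
  | nil => simp at hp
  | @cons _ j _ hadj q =>
    have hq : G.dist i j ≤ k := by
      have := G.dist_le q
      rw [dist_comm] at this
      simp only [Walk.length_cons] at hp
      omega
    have := hG.dist_le_dist_add_one_of_adj hadj.symm i
    exact ⟨j, by omega, hadj.symm⟩

end SimpleGraph

theorem masking_extracts_next_order {V : Type*} [Fintype V] [DecidableEq V]
    (G : SimpleGraph V) [DecidableRel G.Adj] (hG : G.Connected) (k : ℕ) (hk : 1 ≤ k)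
    (M : ℕ → Matrix V V ℝ)
    (hM : ∀ m i j, M m i j = if G.dist i j = m then 1 else 0)
    (Mask : Matrix V V ℝ)
    (hMask : ∀ i l, Mask i l = if 0 < (M (k - 1) + M k) i l then 0 else 1) :
    ∀ i l, (Matrix.hadamard (M k * G.adjMatrix ℝ) Mask) i l ≠ 0 ↔ G.dist i l = k + 1 := by
  intro i l
  have hprod : (M k * G.adjMatrix ℝ) i l ≠ 0 ↔ ∃ j, G.dist i j = k ∧ G.Adj j l := by
    rw [Matrix.mul_apply, ne_eq, Finset.sum_eq_zero_iff_of_nonneg]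
    · simp [hM, SimpleGraph.adjMatrix_apply, and_comm]
    · intro j _
      rw [hM, SimpleGraph.adjMatrix_apply]
      positivity
  have hmask : Mask i l ≠ 0 ↔ G.dist i l ≠ k - 1 ∧ G.dist i l ≠ k := by
    rw [hMask, Matrix.add_apply, hM, hM]
    grind
  rw [Matrix.hadamard_apply, mul_ne_zero_iff, hprod, hmask]
  constructor
  · rintro ⟨⟨j, hj, hadj⟩, h₁, h₂⟩
    have := hG.dist_le_dist_add_one_of_adj hadj i
    have := hG.dist_le_dist_add_one_of_adj hadj.symm i
    omega
  · intro h
    exact ⟨hG.exists_adj_dist_eq_of_dist_eq_add_one h, by omega, by omega⟩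
end

section
/- Let G be a connected simple graph on a finite vertex set V with adjacency matrix A over ℝ. Define a sequence of matrices by B 0 = identity, B 1 = A, and for l ≥ 1, B (l+1) i j = 0 if (B (l−1) + B l) i j > 0, and B (l+1) i j = (B l * A) i j otherwise. Then for every l ∈ ℕ and all vertices i, j: (B l) i j ≠ 0 if and only if dist(i, j) = l; moreover every entry of every B l is nonnegative. (Full correctness of Algorithm 1: the second-order deterministic masking process computes matrices whose supports are exactly the rectified l-order proximity relations.) -/
/-- A vertex at distance `l + 1` from `i` has a neighbor at distance `l` from `i`. -/
lemma SimpleGraph.exists_adj_dist_eq_of_dist_eq_succ {V : Type*} {G : SimpleGraph V}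
    {i j : V} {l : ℕ} (h : G.dist i j = l + 1) :
    ∃ k, G.Adj j k ∧ G.dist i k = l := by
  rw [SimpleGraph.dist_comm] at h
  obtain ⟨p, hp⟩ := SimpleGraph.exists_walk_of_dist_ne_zero (by omega : G.dist j i ≠ 0)
  cases p with
  | nil => simp at h
  | @cons _ k _ hjk q =>
    rw [SimpleGraph.Walk.length_cons] at hp
    have hq := SimpleGraph.dist_le q
    have hd := hjk.symm.diff_dist_adj (u := i)
    rw [SimpleGraph.dist_comm (u := i) (v := j), SimpleGraph.dist_comm (u := i) (v := k)] at hd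
    exact ⟨k, hjk, by rw [SimpleGraph.dist_comm]; omega⟩

/-- If `M` is nonnegative and supported on the pairs at distance `l`, then the entries of
`M * A` at pairs whose distance is neither `l - 1` nor `l` are nonzero exactly at distance
`l + 1`. -/
lemma SimpleGraph.mul_adjMatrix_ne_zero_iff_dist_eq_succ {V : Type*} [Fintype V]
    {G : SimpleGraph V} [DecidableRel G.Adj] {M : Matrix V V ℝ} {l : ℕ}
    (hM : ∀ i j, (M i j ≠ 0 ↔ G.dist i j = l) ∧ 0 ≤ M i j) {i j : V}
    (hpred : G.dist i j ≠ l - 1) (hl : G.dist i j ≠ l) :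
    (M * G.adjMatrix ℝ) i j ≠ 0 ↔ G.dist i j = l + 1 := by
  rw [SimpleGraph.mul_adjMatrix_apply, Ne,
    Finset.sum_eq_zero_iff_of_nonneg fun k _ => (hM i k).2]
  push Not
  simp only [(hM i _).1, SimpleGraph.mem_neighborFinset]
  refine ⟨?_, SimpleGraph.exists_adj_dist_eq_of_dist_eq_succ⟩
  rintro ⟨k, hjk, hk⟩
  have hd := hjk.symm.diff_dist_adj (u := i)
  omega

theorem algorithm_one_correctness {V : Type*} [Fintype V] [DecidableEq V]
    (G : SimpleGraph V) [DecidableRel G.Adj] (hG : G.Connected)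
    (B : ℕ → Matrix V V ℝ)
    (hB0 : B 0 = 1)
    (hB1 : B 1 = G.adjMatrix ℝ)
    (hBrec : ∀ l, 1 ≤ l → ∀ i j : V,
      B (l + 1) i j =
        if 0 < (B (l - 1) + B l) i j then 0 else (B l * G.adjMatrix ℝ) i j) :
    ∀ (l : ℕ) (i j : V), (B l i j ≠ 0 ↔ G.dist i j = l) ∧ 0 ≤ B l i j := by
  have pos_iff {l : ℕ} (hl : ∀ i j : V, (B l i j ≠ 0 ↔ G.dist i j = l) ∧ 0 ≤ B l i j) (i j : V) :
      0 < B l i j ↔ G.dist i j = l := by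
    rw [← (hl i j).1, (hl i j).2.lt_iff_ne']
  intro l
  induction l using Nat.twoStepInduction with
  | zero =>
    intro i j
    rw [hB0, hG.dist_eq_zero_iff, Matrix.one_apply]
    split_ifs with h <;> simp [h]
  | one =>
    intro i j
    rw [hB1, SimpleGraph.dist_eq_one_iff_adj, SimpleGraph.adjMatrix_apply]
    split_ifs with h <;> simp [h]
  | more l ih ih' =>
    intro i j
    have hrec := hBrec (l + 1) (by omega) i j
    rw [Nat.add_sub_cancel, Matrix.add_apply] at hrec
    rw [hrec]
    have h₀ := pos_iff ih i j
    have h₁ := pos_iff ih' i j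
    split_ifs with h
    · have hd : G.dist i j = l ∨ G.dist i j = l + 1 := by
        rw [← h₀, ← h₁]
        by_contra! hn
        linarith
      refine ⟨?_, le_rfl⟩
      simp only [ne_eq, not_true_eq_false, false_iff]
      omega
    · refine ⟨SimpleGraph.mul_adjMatrix_ne_zero_iff_dist_eq_succ ih' ?_ ?_, ?_⟩
      · rw [Nat.add_sub_cancel, Ne, ← h₀]
        exact fun hp => h (add_pos_of_pos_of_nonneg hp (ih' i j).2)
      · rw [Ne, ← h₁]
        exact fun hp => h (add_pos_of_nonneg_of_pos (ih i j).2 hp)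
      · rw [SimpleGraph.mul_adjMatrix_apply]
        exact Finset.sum_nonneg fun k _ => (ih' i k).2
end
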